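/- Suppose nonnegative reals p_1,…,p_n satisfy p_i ≤ (1/36)·Σ_k p_k for all i. If S is a uniformly random subset of [n] with each element included independently with probability 1/2, then Pr[(1/3)·Σ_k p_k ≤ Σ_{i∈S} p_i ≤ (2/3)·Σ_k p_k] ≥ 3/4. -/

import Mathlib

open Finset

theorem powerset_second_moment {ι : Type*} [DecidableEq ι] (p : ι → ℝ) (s : Finset ι) :
    ∀ c : ℝ, ∑ S ∈ s.powerset, (c + ∑ i ∈ S, p i - (∑ i ∈ s, p i) / 2) ^ 2
      = 2 ^ s.card * (c ^ 2 + (∑ i ∈ s, p i ^ 2) / 4) := by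
  induction s using Finset.induction_on with
  | empty => intro c; simp
  | insert a s ha ih =>
    intro c
    rw [Finset.sum_powerset_insert ha, Finset.card_insert_of_notMem ha,
      Finset.sum_insert ha, Finset.sum_insert ha]
    have h1 := ih (c - p a / 2)
    have h2 := ih (c + p a / 2)
    have e1 : ∑ S ∈ s.powerset, (c + ∑ i ∈ S, p i - (p a + ∑ i ∈ s, p i) / 2) ^ 2
        = ∑ S ∈ s.powerset, (c - p a / 2 + ∑ i ∈ S, p i - (∑ i ∈ s, p i) / 2) ^ 2 :=
      Finset.sum_congr rfl fun S _ => by ring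
    have e2 : ∑ S ∈ s.powerset,
          (c + ∑ i ∈ insert a S, p i - (p a + ∑ i ∈ s, p i) / 2) ^ 2
        = ∑ S ∈ s.powerset, (c + p a / 2 + ∑ i ∈ S, p i - (∑ i ∈ s, p i) / 2) ^ 2 := by
      refine Finset.sum_congr rfl fun S hS => ?_
      rw [Finset.sum_insert (fun h => ha (Finset.mem_powerset.1 hS h))]
      ring
    rw [e1, e2, h1, h2]
    ring

/-- Concentration lemma: if nonnegative payments satisfy `p i ≤ (Σ p)/36` for all `i`,
then a uniformly random subset `S` (each element included independently with
probability 1/2, i.e. uniform over all `2^n` subsets) satisfies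
`(Σ p)/3 ≤ Σ_{i ∈ S} p i ≤ 2(Σ p)/3` with probability at least `3/4`. -/
theorem stmt_7 (n : ℕ) (p : Fin n → ℝ)
    (hp : ∀ i, 0 ≤ p i)
    (hbound : ∀ i, p i ≤ (∑ k, p k) / 36) :
    (3 : ℝ) / 4 ≤
      ((Finset.univ.filter (fun S : Finset (Fin n) =>
          (∑ k, p k) / 3 ≤ ∑ i ∈ S, p i ∧ ∑ i ∈ S, p i ≤ 2 * (∑ k, p k) / 3)).card : ℝ)
        / 2 ^ n := by
  set T := ∑ k, p k with hT
  have hT0 : 0 ≤ T := Finset.sum_nonneg fun i _ => hp i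
  have hm := powerset_second_moment p Finset.univ 0
  rw [Finset.powerset_univ, Finset.card_univ, Fintype.card_fin, ← hT] at hm
  have hsq : ∑ i, p i ^ 2 ≤ T ^ 2 / 36 := by
    calc ∑ i, p i ^ 2 ≤ ∑ i, p i * (T / 36) := Finset.sum_le_sum fun i _ => by
          rw [sq]; exact mul_le_mul_of_nonneg_left (hbound i) (hp i)
      _ = T ^ 2 / 36 := by rw [← Finset.sum_mul, ← hT]; ring
  have h2 : (0 : ℝ) < 2 ^ n := by positivity
  rw [le_div_iff₀ h2]
  set P : Finset (Fin n) → Prop := fun S => T / 3 ≤ ∑ i ∈ S, p i ∧ ∑ i ∈ S, p i ≤ 2 * T / 3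
    with hP
  have hcard : ((Finset.univ.filter P).card : ℝ)
      + ((Finset.univ.filter fun S => ¬ P S).card : ℝ) = 2 ^ n := by
    have := Finset.card_filter_add_card_filter_not (s := (Finset.univ : Finset (Finset (Fin n)))) P
    rw [Finset.card_univ, Fintype.card_finset, Fintype.card_fin] at this
    exact_mod_cast this
  rcases hT0.eq_or_lt with h0 | hpos
  · have hz : ∀ i, p i = 0 := fun i => le_antisymm (by have := hbound i; linarith) (hp i)
    have hall : (Finset.univ.filter fun S => ¬ P S) = ∅ := by
      apply Finset.filter_eq_empty_iff.2
      intro S _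
      simp [hP, hz, ← h0]
    rw [hall] at hcard
    simp only [Finset.card_empty, Nat.cast_zero] at hcard
    linarith
  · have hlow : ((Finset.univ.filter fun S => ¬ P S).card : ℝ) * (T ^ 2 / 36)
        ≤ ∑ S : Finset (Fin n), (0 + ∑ i ∈ S, p i - T / 2) ^ 2 := by
      rw [← nsmul_eq_mul]
      refine (Finset.card_nsmul_le_sum _ (fun S => (0 + ∑ i ∈ S, p i - T / 2) ^ 2) _ ?_).trans
        (Finset.sum_le_sum_of_subset_of_nonneg (Finset.filter_subset _ _)
          fun _ _ _ => sq_nonneg _)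
      intro S hS
      have hS' : ¬ P S := (Finset.mem_filter.1 hS).2
      simp only [hP, not_and_or, not_le] at hS'
      rcases hS' with h | h <;> nlinarith
    rw [hm] at hlow
    have hT2 : 0 < T ^ 2 := by positivity
    have hb : ((Finset.univ.filter fun S => ¬ P S).card : ℝ) ≤ 2 ^ n / 4 := by
      have : (2 : ℝ) ^ n * (0 ^ 2 + (∑ i, p i ^ 2) / 4) ≤ 2 ^ n * (T ^ 2 / 36 / 4) :=
        mul_le_mul_of_nonneg_left (by linarith) h2.le
      refine le_of_mul_le_mul_right ?_ (show 0 < T ^ 2 / 36 by positivity)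
      linarith
    linarith
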